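/- Let d ≥ 2 and let X be an ℕ^d shift over the binary alphabet {0,1}. Then the entropy h(X) is positive if and only if X has an independence set S ⊆ ℕ^d whose upper density d̄(S) is positive. -/

import Mathlib

open Filter

/-- `X` is an `ℕ^d` shift over the binary alphabet: a closed subset of `Bool ^ (ℕ^d)`
invariant under each of the `d` one-sided coordinate shift maps. -/
def IsNdShift (d : ℕ) (X : Set ((Fin d → ℕ) → Bool)) : Prop :=
  IsClosed X ∧ ∀ x ∈ X, ∀ i : Fin d, (fun v => x (v + Pi.single i 1)) ∈ X

/-- The number of blocks of `X` on the box `∏ᵢ [0, nᵢ)`, i.e. the number of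
restrictions of points of `X` to this box. -/
noncomputable def ndBlockCount (d : ℕ) (X : Set ((Fin d → ℕ) → Bool)) (n : Fin d → ℕ) : ℕ :=
  Set.ncard ((fun x (v : ∀ i, Fin (n i)) => x (fun i => (v i : ℕ))) '' X)

/-- The (topological) entropy of an `ℕ^d` shift,
`h(X) = lim_{n₁,…,n_d → ∞} log |B_{n₁,…,n_d}(X)| / (n₁⋯n_d)`
(written with `limsup`, which agrees with the limit whenever the latter exists). -/
noncomputable def ndEntropy (d : ℕ) (X : Set ((Fin d → ℕ) → Bool)) : ℝ :=
  limsup (fun n : Fin d → ℕ => Real.log (ndBlockCount d X n) / ∏ i, (n i : ℝ)) atTop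

/-- `S` is an independence set for `X`: every assignment of symbols on `S`
is realized by some point of `X`. -/
def IsIndepSet {I A : Type*} (X : Set (I → A)) (S : Set I) : Prop :=
  ∀ u : I → A, ∃ x ∈ X, ∀ i ∈ S, x i = u i

/-- The upper density of a set `S ⊆ ℕ^d`:
`limsup_{n₁,…,n_d → ∞} |S ∩ ∏ᵢ [0,nᵢ)| / (n₁⋯n_d)`. -/
noncomputable def ndUpperDensity (d : ℕ) (S : Set (Fin d → ℕ)) : ℝ :=
  limsup (fun n : Fin d → ℕ =>
    ((S ∩ {v | ∀ i, v i < n i}).ncard : ℝ) / ∏ i, (n i : ℝ)) atTop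


namespace NdAux

/-- box -/
def bx {d : ℕ} (n : Fin d → ℕ) : Finset (Fin d → ℕ) := Fintype.piFinset fun i => Finset.range (n i)

theorem mem_bx {d : ℕ} {n v : Fin d → ℕ} : v ∈ bx n ↔ ∀ i, v i < n i := by
  simp [bx]

theorem card_bx {d : ℕ} (n : Fin d → ℕ) : (bx n).card = ∏ i, n i := by
  simp [bx]

/-- volume -/
noncomputable def vol {d : ℕ} (n : Fin d → ℕ) : ℝ := ∏ i, (n i : ℝ)

theorem card_bx' {d : ℕ} (n : Fin d → ℕ) : ((bx n).card : ℝ) = vol n := by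
  simp [card_bx, vol]

theorem vol_nonneg {d : ℕ} (n : Fin d → ℕ) : 0 ≤ vol n := by
  unfold vol; positivity

theorem vol_pos {d : ℕ} {n : Fin d → ℕ} (h : ∀ i, 0 < n i) : 0 < vol n := by
  unfold vol
  exact Finset.prod_pos fun i _ => by exact_mod_cast h i

/-- weight -/
def g (b : Bool) : ℝ := if b then 1 else 0

theorem g_nonneg (b : Bool) : 0 ≤ g b := by cases b <;> simp [g]
theorem g_le_one (b : Bool) : g b ≤ 1 := by cases b <;> simp [g]

/-- count -/
noncomputable def cnt {d : ℕ} (s : (Fin d → ℕ) → Bool) (n : Fin d → ℕ) : ℝ := ∑ v ∈ bx n, g (s v)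

theorem cnt_le {d : ℕ} (s : (Fin d → ℕ) → Bool) (n : Fin d → ℕ) : cnt s n ≤ vol n := by
  rw [← card_bx']
  unfold cnt
  calc _ ≤ ∑ v ∈ bx n, (1:ℝ) := Finset.sum_le_sum fun v _ => g_le_one _
    _ = _ := by simp

theorem cnt_eq {d : ℕ} (s : (Fin d → ℕ) → Bool) (n : Fin d → ℕ) :
    cnt s n = (({v | s v = true} ∩ {v | ∀ i, v i < n i} : Set (Fin d → ℕ)).ncard : ℝ) := by
  have : ({v | s v = true} ∩ {v | ∀ i, v i < n i} : Set (Fin d → ℕ))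
      = ((bx n).filter (fun v => s v = true) : Finset (Fin d → ℕ)) := by
    ext v; simp [mem_bx, and_comm]
  rw [this, Set.ncard_coe_finset]
  simp [cnt, g]

theorem shift_all {d : ℕ} {X : Set ((Fin d → ℕ) → Bool)} (hX : IsNdShift d X) (w : Fin d → ℕ) :
    ∀ x ∈ X, (fun v => x (v + w)) ∈ X := by
  let M : AddSubmonoid (Fin d → ℕ) :=
    { carrier := {w | ∀ x ∈ X, (fun v => x (v + w)) ∈ X}
      zero_mem' := by intro x hx; simpa using hx
      add_mem' := by
        intro a b ha hb x hx
        have := ha _ (hb x hx)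
        simpa [add_assoc] using this }
  have h : ∑ i, (w i) • (Pi.single i 1 : Fin d → ℕ) ∈ M :=
    M.sum_mem fun i _ => M.nsmul_mem (fun x hx => hX.2 x hx i) _
  have e : ∑ i, (w i) • (Pi.single i 1 : Fin d → ℕ) = w := by
    ext j
    simp [Finset.sum_apply, Pi.single_apply]
  rw [e] at h
  exact h

/-- independent indicator functions -/
def Ind {d : ℕ} (X : Set ((Fin d → ℕ) → Bool)) : Set ((Fin d → ℕ) → Bool) :=
  {s | IsIndepSet X {v | s v = true}}

theorem ind_shift {d : ℕ} {X : Set ((Fin d → ℕ) → Bool)} (hX : IsNdShift d X) (w : Fin d → ℕ)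
    {s : (Fin d → ℕ) → Bool} (hs : s ∈ Ind X) : (fun v => s (v + w)) ∈ Ind X := by
  intro u
  obtain ⟨x, hx, h⟩ := hs (fun j => u (j - w))
  refine ⟨_, shift_all hX w x hx, fun i hi => ?_⟩
  have := h (i + w) hi
  simpa using this

theorem ind_closed {d : ℕ} {X : Set ((Fin d → ℕ) → Bool)} (hX : IsClosed X) : IsClosed (Ind X) := by
  have e : Ind X = ⋂ u : (Fin d → ℕ) → Bool,
      Prod.fst '' {p : ((Fin d → ℕ) → Bool) × ((Fin d → ℕ) → Bool) |
        p.2 ∈ X ∧ ∀ i, p.1 i = true → p.2 i = u i} := by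
    ext s
    simp [Ind, IsIndepSet]
  rw [e]
  refine isClosed_iInter fun u => ?_
  refine isClosedMap_fst_of_compactSpace _ ?_
  have e2 : {p : ((Fin d → ℕ) → Bool) × ((Fin d → ℕ) → Bool) |
        p.2 ∈ X ∧ ∀ i, p.1 i = true → p.2 i = u i} =
      Prod.snd ⁻¹' X ∩ ⋂ i, (fun p : ((Fin d → ℕ) → Bool) × ((Fin d → ℕ) → Bool) =>
        (p.1 i, p.2 i)) ⁻¹' {q : Bool × Bool | q.1 = true → q.2 = u i} := by
    ext p
    simp
  rw [e2]
  refine (hX.preimage continuous_snd).inter ?_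
  refine isClosed_iInter fun i => ?_
  have : Continuous fun p : ((Fin d → ℕ) → Bool) × ((Fin d → ℕ) → Bool) => (p.1 i, p.2 i) := by
    fun_prop
  exact (isClosed_discrete {q : Bool × Bool | q.1 = true → q.2 = u i}).preimage this

theorem cnt_cont {d : ℕ} (n : Fin d → ℕ) : Continuous fun s : (Fin d → ℕ) → Bool => cnt s n := by
  unfold cnt
  refine continuous_finsetSum _ fun v _ => ?_
  exact (continuous_of_discreteTopology (f := g)).comp (continuous_apply v)

theorem vol_sub {d : ℕ} {γ : ℝ} (hγ : 0 < γ) : ∃ K : ℕ, ∀ n N a : Fin d → ℕ,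
    (∀ i, K * n i ≤ N i) → (∀ i, a i < n i) → (1 - γ) * vol N ≤ vol (N - a) := by
  obtain ⟨K, hK⟩ := exists_nat_gt (d / γ)
  refine ⟨K + 1, fun n N a h1 h2 => ?_⟩
  have hK0 : (0:ℝ) < K + 1 := by positivity
  have hdk : d / ((K:ℝ) + 1) ≤ γ := by
    rw [div_lt_iff₀ hγ] at hK
    rw [div_le_iff₀ hK0]
    nlinarith
  have hb : 1 - γ ≤ (1 - 1 / ((K:ℝ)+1)) ^ d := by
    have := one_add_mul_le_pow (a := - (1 / ((K:ℝ)+1))) (by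
      have : 1 / ((K:ℝ)+1) ≤ 1 := by rw [div_le_one hK0]; simp
      linarith) d
    have e : (d:ℝ) * -(1 / ((K:ℝ)+1)) = - (d / ((K:ℝ) + 1)) := by ring
    rw [e] at this
    calc 1 - γ ≤ 1 + -(d / ((K:ℝ)+1)) := by linarith
      _ ≤ _ := by simpa [sub_eq_add_neg] using this
  calc (1 - γ) * vol N ≤ (1 - 1 / ((K:ℝ)+1)) ^ d * vol N :=
        mul_le_mul_of_nonneg_right hb (vol_nonneg _)
    _ = ∏ i, ((1 - 1 / ((K:ℝ)+1)) * (N i : ℝ)) := by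
        simp [vol, Finset.prod_mul_distrib]
    _ ≤ vol (N - a) := by
        unfold vol
        refine Finset.prod_le_prod (fun i _ => ?_) (fun i _ => ?_)
        · have : 1 / ((K:ℝ)+1) ≤ 1 := by rw [div_le_one hK0]; simp
          exact mul_nonneg (by linarith) (by positivity)
        · have h3 : ((K:ℝ)+1) * n i ≤ N i := by exact_mod_cast h1 i
          have h4 : (a i : ℝ) ≤ n i := by exact_mod_cast (h2 i).le
          have h5 : (n i : ℝ) ≤ 1 / ((K:ℝ)+1) * N i := by
            rw [one_div, inv_mul_eq_div, le_div_iff₀ hK0]; linarith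
          have h6 : a i ≤ N i := by
            have := h1 i; have := h2 i; nlinarith
          rw [Pi.sub_apply, Nat.cast_sub h6]
          linarith

theorem sum_shift {d : ℕ} (s : (Fin d → ℕ) → Bool) (N a : Fin d → ℕ) (haN : a ≤ N) :
    cnt s N - (vol N - vol (N - a)) ≤ ∑ v ∈ bx N, g (s (v + a)) := by
  classical
  have hinj : Function.Injective (fun v : Fin d → ℕ => v + a) := add_left_injective a
  set P := (bx N).image (fun v => v + a) with hP
  set Q := (bx (N - a)).image (fun v => v + a) with hQ
  have hQN : Q ⊆ bx N := by
    intro u hu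
    obtain ⟨v, hv, rfl⟩ := Finset.mem_image.1 hu
    rw [mem_bx] at hv ⊢
    intro i
    have := hv i
    simp only [Pi.sub_apply, Pi.add_apply] at this ⊢
    omega
  have hQP : Q ⊆ P := by
    refine Finset.image_subset_image ?_
    intro v hv
    rw [mem_bx] at hv ⊢
    intro i
    have := hv i
    simp only [Pi.sub_apply] at this
    omega
  have hsumP : ∑ u ∈ P, g (s u) = ∑ v ∈ bx N, g (s (v + a)) :=
    Finset.sum_image (fun _ _ _ _ h => hinj h)
  have hcQ : (Q.card : ℝ) = vol (N - a) := by
    rw [hQ, Finset.card_image_of_injective _ hinj, card_bx']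
  have hsplit : cnt s N = ∑ u ∈ bx N \ Q, g (s u) + ∑ u ∈ Q, g (s u) :=
    (Finset.sum_sdiff hQN).symm
  have h1 : ∑ u ∈ bx N \ Q, g (s u) ≤ vol N - vol (N - a) := by
    calc _ ≤ ∑ u ∈ bx N \ Q, (1:ℝ) := Finset.sum_le_sum fun v _ => g_le_one _
      _ = vol N - vol (N - a) := by
        rw [Finset.sum_const, nsmul_eq_mul, mul_one, Finset.cast_card_sdiff hQN, hcQ, card_bx']
  have h2 : ∑ u ∈ Q, g (s u) ≤ ∑ u ∈ P, g (s u) :=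
    Finset.sum_le_sum_of_subset_of_nonneg hQP fun _ _ _ => g_nonneg _
  linarith

theorem bad_bound {d : ℕ} (s : (Fin d → ℕ) → Bool) (N n : Fin d → ℕ) (D ε γ : ℝ)
    (hD : 0 < D) (hε : 0 < ε) (hn : ∀ i, 0 < n i) (hnN : n ≤ N)
    (hsN : (D - γ) * vol N ≤ cnt s N)
    (hvol : ∀ a ∈ bx n, (1 - γ) * vol N ≤ vol (N - a))
    (hub : ∀ v, cnt (fun u => s (u + v)) n ≤ (D + ε) * vol n) :
    (((bx N).filter fun v => cnt (fun u => s (u + v)) n < D / 2 * vol n).card : ℝ) * (D / 2)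
      ≤ (ε + 2 * γ) * vol N := by
  classical
  set B := (bx N).filter fun v => cnt (fun u => s (u + v)) n < D / 2 * vol n with hB
  have hBN : B ⊆ bx N := Finset.filter_subset _ _
  have hv := vol_pos hn
  have lower : vol n * ((D - 2 * γ) * vol N) ≤ ∑ v ∈ bx N, cnt (fun u => s (u + v)) n := by
    unfold cnt
    rw [Finset.sum_comm]
    rw [← card_bx' n, ← nsmul_eq_mul]
    refine Finset.card_nsmul_le_sum _ _ _ fun a ha => ?_
    have h1 := sum_shift s N a (fun i => ((mem_bx.1 ha i).le.trans (hnN i)))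
    have h2 := hvol a ha
    simp_rw [add_comm a]
    linarith
  have upper : ∑ v ∈ bx N, cnt (fun u => s (u + v)) n ≤
      B.card * (D / 2 * vol n) + (vol N - B.card) * ((D + ε) * vol n) := by
    rw [← Finset.sum_sdiff hBN, add_comm]
    refine add_le_add ?_ ?_
    · rw [← nsmul_eq_mul]
      refine Finset.sum_le_card_nsmul _ _ _ fun v hv => (Finset.mem_filter.1 hv).2.le
    · rw [← card_bx' N, ← Finset.cast_card_sdiff hBN, ← nsmul_eq_mul]
      exact Finset.sum_le_card_nsmul _ _ _ fun v hv => hub v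
  have h := lower.trans upper
  have h' : vol n * ((D - 2 * γ) * vol N) ≤
      vol n * (B.card * (D / 2) + (vol N - B.card) * (D + ε)) := by
    refine h.trans (le_of_eq ?_); ring
  have h2 := le_of_mul_le_mul_left h' hv
  have h3 : (0:ℝ) ≤ B.card * ε := by positivity
  nlinarith

theorem exists_good {d : ℕ} {X : Set ((Fin d → ℕ) → Bool)} (hX : IsNdShift d X) (D : ℝ) (hD : 0 < D)
    (hfreq : ∀ ε > 0, ∃ᶠ n in atTop, ∃ s ∈ Ind X, (D - ε) * vol n ≤ cnt s n)
    (n : ℕ → Fin d → ℕ) (hn : ∀ m i, 0 < n m i)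
    (hub : ∀ m, ∀ s ∈ Ind X, cnt s (n m) ≤ (D + D / 8 * (1 / 2) ^ m) * vol (n m)) (M : ℕ) :
    ∃ s ∈ Ind X, ∀ m < M, D / 2 * vol (n m) ≤ cnt s (n m) := by
  classical
  set γ : ℝ := D / (8 * (M + 1)) with hγd
  have hγ : 0 < γ := by positivity
  obtain ⟨K, hK⟩ := vol_sub (d := d) hγ
  obtain ⟨N, ⟨s, hs, hsN⟩, hN⟩ := ((hfreq γ hγ).and_eventually (eventually_ge_atTop
    (fun i => 1 + ∑ m ∈ Finset.range M, (K + 1) * n m i))).exists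
  have hNm : ∀ m < M, ∀ i, (K + 1) * n m i ≤ N i := by
    intro m hm i
    have h1 := hN i
    have h2 : (K + 1) * n m i ≤ ∑ m ∈ Finset.range M, (K + 1) * n m i :=
      Finset.single_le_sum (f := fun m => (K + 1) * n m i) (fun _ _ => Nat.zero_le _)
        (Finset.mem_range.2 hm)
    simp only at h1
    omega
  have hNpos : 0 < vol N := vol_pos fun i => by have := hN i; simp only at this; omega
  by_contra hcon
  push Not at hcon
  have hcov : bx N ⊆ (Finset.range M).biUnion fun m =>
      (bx N).filter fun v => cnt (fun u => s (u + v)) (n m) < D / 2 * vol (n m) := by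
    intro v hv
    obtain ⟨m, hm, h⟩ := hcon _ (ind_shift hX v hs)
    simp only [Finset.mem_biUnion, Finset.mem_range, Finset.mem_filter]
    exact ⟨m, hm, hv, h⟩
  have hcard := (Finset.card_le_card hcov).trans Finset.card_biUnion_le
  have hcardR : vol N ≤ ∑ m ∈ Finset.range M,
      (((bx N).filter fun v => cnt (fun u => s (u + v)) (n m) < D / 2 * vol (n m)).card : ℝ) := by
    rw [← card_bx']; exact_mod_cast hcard
  have hsum : vol N * (D / 2) ≤ ∑ m ∈ Finset.range M, (D / 8 * (1 / 2) ^ m + 2 * γ) * vol N := by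
    refine (mul_le_mul_of_nonneg_right hcardR (by positivity)).trans ?_
    rw [Finset.sum_mul]
    refine Finset.sum_le_sum fun m hm => ?_
    have hm' := Finset.mem_range.1 hm
    refine bad_bound s N (n m) D _ γ hD (by positivity) (hn m) (fun i => ?_) hsN ?_ ?_
    · exact (Nat.le_mul_of_pos_left _ (Nat.succ_pos K)).trans (hNm m hm' i)
    · intro a ha
      refine hK (n m) N a (fun i => ?_) (mem_bx.1 ha)
      have := hNm m hm' i
      nlinarith
    · intro v
      exact hub m _ (ind_shift hX v hs)
  rw [← Finset.sum_mul, Finset.sum_add_distrib, ← Finset.mul_sum] at hsum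
  have hgeo : ∑ m ∈ Finset.range M, ((1:ℝ) / 2) ^ m ≤ 2 := sum_geometric_two_le M
  have hg : (M:ℝ) * (2 * γ) < D / 4 := by
    rw [hγd]
    have : (M:ℝ) * (2 * (D / (8 * (M + 1)))) = D / 4 * (M / (M + 1)) := by field_simp; ring
    rw [this]
    have h1 : (M:ℝ) / (M + 1) < 1 := by rw [div_lt_one (by positivity)]; simp
    nlinarith
  simp only [Finset.sum_const, Finset.card_range, nsmul_eq_mul] at hsum
  rw [mul_comm (vol N)] at hsum
  have hsum2 := le_of_mul_le_mul_right hsum hNpos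
  have hgeo2 := mul_le_mul_of_nonneg_left hgeo (show 0 ≤ D / 8 by positivity)
  linarith

theorem exists_dense {d : ℕ} {X : Set ((Fin d → ℕ) → Bool)} (hX : IsNdShift d X) (δ : ℝ) (hδ : 0 < δ)
    (hf : ∃ᶠ n in atTop, ∃ s ∈ Ind X, δ * vol n ≤ cnt s n) :
    ∃ s ∈ Ind X, ∃ c > 0, ∃ᶠ n in atTop, c * vol n ≤ cnt s n := by
  set P : Set ℝ := {a | ∃ᶠ n in atTop, ∃ s ∈ Ind X, a * vol n ≤ cnt s n} with hP
  have hbdd : BddAbove P := by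
    refine ⟨1, fun a ha => ?_⟩
    obtain ⟨n, ⟨s, _, h⟩, hn⟩ := (ha.and_eventually (eventually_ge_atTop (fun _ => 1))).exists
    have hv : 0 < vol n := vol_pos fun i => hn i
    have := h.trans (cnt_le s n)
    by_contra hc
    nlinarith
  set D := sSup P with hDd
  have hD : 0 < D := hδ.trans_le (le_csSup hbdd hf)
  have hfreq : ∀ ε > 0, ∃ᶠ n in atTop, ∃ s ∈ Ind X, (D - ε) * vol n ≤ cnt s n := by
    intro ε hε
    obtain ⟨a, ha, hlt⟩ := exists_lt_of_lt_csSup ⟨δ, hf⟩ (show D - ε < sSup P by linarith)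
    refine Frequently.mono ha ?_
    rintro n ⟨s, hs, h⟩
    exact ⟨s, hs, (mul_le_mul_of_nonneg_right hlt.le (vol_nonneg n)).trans h⟩
  have hub : ∀ m : ℕ, ∃ n : Fin d → ℕ, (∀ i, m + 1 ≤ n i) ∧
      ∀ s ∈ Ind X, cnt s n ≤ (D + D / 8 * (1 / 2) ^ m) * vol n := by
    intro m
    have h1 : D + D / 8 * (1 / 2) ^ m ∉ P := by
      intro h
      have := le_csSup hbdd h
      have : 0 < D / 8 * (1 / 2 : ℝ) ^ m := by positivity
      linarith
    rw [hP, Set.mem_ofPred_eq, not_frequently] at h1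
    obtain ⟨n, h, hn⟩ := (h1.and (eventually_ge_atTop (fun _ => m + 1))).exists
    push Not at h
    exact ⟨n, hn, fun s hs => (h s hs).le⟩
  choose n hn hnub using hub
  have hgood := exists_good hX D hD hfreq n (fun m i => by have := hn m i; omega) hnub
  let C : ℕ → Set ((Fin d → ℕ) → Bool) := fun M =>
    Ind X ∩ ⋂ m, ⋂ (_ : m < M), {s | D / 2 * vol (n m) ≤ cnt s (n m)}
  have hCc : ∀ M, IsClosed (C M) := fun M =>
    (ind_closed hX.1).inter (isClosed_iInter fun m => isClosed_iInter fun _ =>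
      isClosed_le continuous_const (cnt_cont _))
  obtain ⟨s, hs⟩ := IsCompact.nonempty_iInter_of_sequence_nonempty_isCompact_isClosed C
    (fun M s hs => by
      simp only [C, Set.mem_inter_iff, Set.mem_iInter] at hs ⊢
      exact ⟨hs.1, fun m hm => hs.2 m (by omega)⟩)
    (fun M => by
      obtain ⟨s, hs, h⟩ := hgood M
      refine ⟨s, hs, ?_⟩
      simp only [Set.mem_iInter]
      exact h)
    (hCc 0).isCompact hCc
  simp only [C, Set.mem_iInter, Set.mem_inter_iff] at hs
  refine ⟨s, (hs 0).1, D / 2, by positivity, ?_⟩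
  rw [frequently_atTop]
  intro n0
  refine ⟨n (∑ i, n0 i), fun i => ?_, (hs (∑ i, n0 i + 1)).2 _ (Nat.lt_succ_self _)⟩
  have h1 := hn (∑ i, n0 i) i
  have h2 : n0 i ≤ ∑ i, n0 i := Finset.single_le_sum (fun _ _ => Nat.zero_le _) (Finset.mem_univ i)
  exact h2.trans ((Nat.le_succ _).trans h1)

theorem block_le {d : ℕ} (X : Set ((Fin d → ℕ) → Bool)) (n : Fin d → ℕ) :
    Real.log (ndBlockCount d X n) ≤ Real.log 2 * vol n := by
  have h : ndBlockCount d X n ≤ 2 ^ (∏ i, n i) := by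
    unfold ndBlockCount
    refine (Set.ncard_le_card _).trans ?_
    simp
  rcases Nat.eq_zero_or_pos (ndBlockCount d X n) with h0 | h0
  · rw [h0]; simp; exact mul_nonneg (Real.log_nonneg (by norm_num)) (vol_nonneg n)
  · have : (ndBlockCount d X n : ℝ) ≤ 2 ^ (∏ i, n i) := by exact_mod_cast h
    have := Real.log_le_log (by exact_mod_cast h0) this
    rw [Real.log_pow] at this
    rw [vol, mul_comm]
    exact_mod_cast this

theorem pow_le_block {d : ℕ} {X : Set ((Fin d → ℕ) → Bool)} {S : Set (Fin d → ℕ)}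
    (hS : IsIndepSet X S) (n : Fin d → ℕ) :
    2 ^ ((S ∩ {v | ∀ i, v i < n i}).ncard) ≤ ndBlockCount d X n := by
  classical
  have e : (S ∩ {v | ∀ i, v i < n i} : Set (Fin d → ℕ))
      = ((bx n).filter (fun v => v ∈ S) : Finset (Fin d → ℕ)) := by
    ext v; simp [mem_bx, and_comm]
  rw [e, Set.ncard_coe_finset, ← Finset.card_powerset, ← Set.ncard_coe_finset]
  choose F hFX hF using hS
  unfold ndBlockCount
  refine Set.ncard_le_ncard_of_injOn
    (fun t => fun v : (∀ i, Fin (n i)) => F (fun w => decide (w ∈ t)) (fun i => (v i : ℕ)))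
    (fun t _ => ⟨_, hFX _, rfl⟩) ?_ (Set.toFinite _)
  intro t ht t' ht' heq
  simp only [Finset.coe_powerset, Set.mem_preimage, Set.mem_powerset_iff, Finset.coe_subset] at ht ht'
  have key : ∀ w ∈ (bx n).filter (fun v => v ∈ S), (w ∈ t ↔ w ∈ t') := by
    intro w hw
    obtain ⟨hwb, hwS⟩ := Finset.mem_filter.1 hw
    have h := congrFun heq (fun i => ⟨w i, mem_bx.1 hwb i⟩)
    simp only at h
    rw [hF _ w hwS, hF _ w hwS] at h
    simpa using h
  ext w
  exact ⟨fun h => (key w (ht h)).1 h, fun h => (key w (ht' h)).2 h⟩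

theorem sauer {d : ℕ} (X : Set ((Fin d → ℕ) → Bool)) (c : ℝ) (hc : 0 < c) :
    ∃ δ > 0, ∀ n : Fin d → ℕ, (∀ i, 0 < n i) → c * vol n ≤ Real.log (ndBlockCount d X n) →
      ∃ s ∈ Ind X, δ * vol n ≤ cnt s n := by
  classical
  set t : ℝ := min (c / 4) (1 / 2) with ht
  have ht0 : 0 < t := lt_min (by positivity) (by norm_num)
  have ht1 : t < 1 := (min_le_right _ _).trans_lt (by norm_num)
  have htc : t ≤ c / 4 := min_le_left _ _
  set L : ℝ := - Real.log t with hL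
  have hL0 : 0 < L := by have := Real.log_neg ht0 ht1; linarith
  refine ⟨c / (4 * L), by positivity, fun n hn hlog => ?_⟩
  have hv := vol_pos hn
  set 𝒜 : Finset (Finset (Fin d → ℕ)) :=
    (bx n).powerset.filter fun T => ∃ x ∈ X, ∀ v ∈ bx n, (v ∈ T ↔ x v = true) with h𝒜
  have hcard : ndBlockCount d X n ≤ 𝒜.card := by
    unfold ndBlockCount
    rw [← Set.ncard_coe_finset 𝒜]
    refine le_trans (Set.ncard_le_ncard (t := (fun T : Finset (Fin d → ℕ) =>
      fun v : (∀ i, Fin (n i)) => decide ((fun i => (v i : ℕ)) ∈ T)) '' (𝒜 : Set _)) ?_ (Set.toFinite _))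
      (Set.ncard_image_le (Finset.finite_toSet _))
    rintro _ ⟨x, hx, rfl⟩
    refine ⟨(bx n).filter (fun v => x v = true), ?_, ?_⟩
    · simp only [h𝒜, Finset.coe_filter, Set.mem_ofPred_eq, Finset.mem_powerset]
      refine ⟨Finset.filter_subset _ _, x, hx, fun v hv => ?_⟩
      simp [hv]
    · funext v
      have : (fun i => (v i : ℕ)) ∈ bx n := mem_bx.2 fun i => (v i).2
      simp [this]
  have hsub : 𝒜.shatterer ⊆ (bx n).powerset := by
    intro T hT
    rw [Finset.mem_shatterer] at hT
    obtain ⟨u, hu, hTu⟩ := hT.exists_superset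
    exact Finset.mem_powerset.2 (hTu.trans (Finset.mem_powerset.1 (Finset.mem_filter.1 hu).1))
  by_contra hcon
  push Not at hcon
  have hsmall : ∀ T ∈ 𝒜.shatterer, (T.card : ℝ) < c / (4 * L) * vol n := by
    intro T hT
    have hTn := Finset.mem_powerset.1 (hsub hT)
    rw [Finset.mem_shatterer] at hT
    have h := hcon (fun v => decide (v ∈ T)) (by
      intro u
      obtain ⟨U, hU, hTU⟩ := hT (Finset.filter_subset (fun v => u v = true) T)
      obtain ⟨-, x, hx, hxU⟩ := Finset.mem_filter.1 hU
      refine ⟨x, hx, fun i hi => ?_⟩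
      have hi' : i ∈ T := by simpa using hi
      have h1 : i ∈ T ∩ U ↔ i ∈ T.filter (fun v => u v = true) := by rw [hTU]
      simp only [Finset.mem_inter, hi', true_and, Finset.mem_filter] at h1
      rw [hxU i (hTn hi')] at h1
      exact Bool.eq_iff_iff.2 h1)
    have e : cnt (fun v => decide (v ∈ T)) n = T.card := by
      unfold cnt g
      simp only [decide_eq_true_eq]
      rw [Finset.sum_ite_mem, Finset.inter_eq_right.2 hTn]
      simp
    rwa [e] at h
  have hexp : (𝒜.card : ℝ) ≤ Real.exp (c / 2 * vol n) := by
    have h1 : (𝒜.card : ℝ) ≤ 𝒜.shatterer.card := by exact_mod_cast 𝒜.card_le_card_shatterer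
    refine h1.trans ?_
    have h2 : (𝒜.shatterer.card : ℝ) ≤
        ∑ T ∈ (bx n).powerset, Real.exp (c / 4 * vol n) * t ^ T.card := by
      calc (𝒜.shatterer.card : ℝ) = ∑ T ∈ 𝒜.shatterer, (1:ℝ) := by simp
        _ ≤ ∑ T ∈ 𝒜.shatterer, Real.exp (c / 4 * vol n) * t ^ T.card := by
          refine Finset.sum_le_sum fun T hT => ?_
          have h3 := hsmall T hT
          have : t ^ T.card = Real.exp (-(L * T.card)) := by
            rw [hL, neg_mul, neg_neg, mul_comm, Real.exp_nat_mul, Real.exp_log ht0]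
          rw [this, ← Real.exp_add]
          refine Real.one_le_exp ?_
          have h4 : L * (c / (4 * L) * vol n) = c / 4 * vol n := by field_simp
          have := mul_lt_mul_of_pos_left h3 hL0
          linarith
        _ ≤ _ := Finset.sum_le_sum_of_subset_of_nonneg hsub fun T _ _ => by positivity
    refine h2.trans ?_
    have h5 : ∑ T ∈ (bx n).powerset, t ^ T.card = (t + 1) ^ (bx n).card := by
      rw [← Finset.sum_pow_mul_eq_add_pow]; simp
    rw [← Finset.mul_sum, h5]
    have h6 : (t + 1) ^ (bx n).card ≤ Real.exp (c / 4 * vol n) := by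
      calc (t + 1) ^ (bx n).card ≤ (Real.exp t) ^ (bx n).card :=
            pow_le_pow_left₀ (by positivity) (Real.add_one_le_exp t) _
        _ = Real.exp (vol n * t) := by rw [← Real.exp_nat_mul, card_bx']
        _ ≤ _ := Real.exp_le_exp.2 (by nlinarith)
    calc _ ≤ Real.exp (c / 4 * vol n) * Real.exp (c / 4 * vol n) :=
          mul_le_mul_of_nonneg_left h6 (Real.exp_pos _).le
      _ = _ := by rw [← Real.exp_add]; ring_nf
  have hpos : (0:ℝ) < ndBlockCount d X n := by
    rcases Nat.eq_zero_or_pos (ndBlockCount d X n) with h0 | h0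
    · rw [h0] at hlog; simp at hlog; nlinarith [mul_pos hc hv]
    · exact_mod_cast h0
  have hle : (ndBlockCount d X n : ℝ) ≤ Real.exp (c / 2 * vol n) :=
    le_trans (by exact_mod_cast hcard) hexp
  have := Real.log_le_log hpos hle
  rw [Real.log_exp] at this
  nlinarith [mul_pos hc hv]

theorem lt_limsup_freq {d : ℕ} (f : (Fin d → ℕ) → ℝ) (hf0 : ∀ n, 0 ≤ f n) (h : 0 < limsup f atTop) :
    ∃ c > 0, ∃ᶠ n in atTop, c < f n := by
  refine ⟨limsup f atTop / 2, by positivity, ?_⟩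
  refine frequently_lt_of_lt_limsup ?_ (by linarith)
  exact IsBoundedUnder.isCoboundedUnder_le (isBoundedUnder_of ⟨0, fun n => hf0 n⟩)

theorem freq_lt_limsup {d : ℕ} (f : (Fin d → ℕ) → ℝ) (C : ℝ) (hfC : ∀ n, f n ≤ C) (c : ℝ) (hc : 0 < c)
    (h : ∃ᶠ n in atTop, c ≤ f n) : 0 < limsup f atTop :=
  hc.trans_le (le_limsup_of_frequently_le h (isBoundedUnder_of ⟨C, fun n => hfC n⟩))

end NdAux

open NdAux in
/-- For `d ≥ 2` and `X` an `ℕ^d` shift over `{0,1}`,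
`h(X) > 0` iff `X` has an independence set of positive upper density. -/
theorem ndShift_pos_entropy_iff_indep_posUpperDensity
    (d : ℕ) (hd : 2 ≤ d) (X : Set ((Fin d → ℕ) → Bool)) (hX : IsNdShift d X) :
    0 < ndEntropy d X ↔
      ∃ S : Set (Fin d → ℕ), IsIndepSet X S ∧ 0 < ndUpperDensity d S := by
  constructor
  · intro h
    obtain ⟨c, hc, hf⟩ := lt_limsup_freq _ (fun n => div_nonneg (Real.log_natCast_nonneg _)
      (vol_nonneg n)) h
    obtain ⟨δ, hδ, hs⟩ := sauer X c hc
    obtain ⟨s, hsI, a, ha, hfa⟩ := exists_dense hX δ hδ (by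
      refine (hf.and_eventually (eventually_ge_atTop (fun _ => 1))).mono ?_
      rintro n ⟨h1, h2⟩
      have hv : 0 < vol n := vol_pos fun i => h2 i
      exact hs n (fun i => h2 i) ((lt_div_iff₀ hv).1 h1).le)
    refine ⟨{v | s v = true}, hsI, ?_⟩
    refine freq_lt_limsup _ 1 (fun n => ?_) a ha ?_
    · rw [← cnt_eq]
      exact div_le_one_of_le₀ (cnt_le s n) (vol_nonneg n)
    · refine (hfa.and_eventually (eventually_ge_atTop (fun _ => 1))).mono ?_
      rintro n ⟨h1, h2⟩
      have hv : 0 < vol n := vol_pos fun i => h2 i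
      rw [← cnt_eq]
      exact (le_div_iff₀ hv).2 h1
  · rintro ⟨S, hS, h⟩
    obtain ⟨c, hc, hf⟩ := lt_limsup_freq _ (fun n => div_nonneg (Nat.cast_nonneg _)
      (vol_nonneg n)) h
    have hl2 : 0 < Real.log 2 := Real.log_pos (by norm_num)
    refine freq_lt_limsup _ (Real.log 2) (fun n => ?_) (c * Real.log 2) (by positivity) ?_
    · exact div_le_of_le_mul₀ (vol_nonneg n) hl2.le (block_le X n)
    · refine (hf.and_eventually (eventually_ge_atTop (fun _ => 1))).mono ?_
      rintro n ⟨h1, h2⟩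
      have hv : 0 < vol n := vol_pos fun i => h2 i
      refine (le_div_iff₀ hv).2 ?_
      have h3 := (lt_div_iff₀ hv).1 h1
      have h4 : (2:ℝ) ^ ((S ∩ {v | ∀ i, v i < n i}).ncard) ≤ ndBlockCount d X n := by
        exact_mod_cast pow_le_block hS n
      have h5 := Real.log_le_log (by positivity) h4
      rw [Real.log_pow] at h5
      nlinarith
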